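/- arXiv:1401.5665 — 2 statements merged into one kernel-verified Lean document; each statement's English description precedes it below -/
import Mathlib

section
/- The interval I_str(C_{01}) has the cardinality of the continuum (2^{ℵ₀}), where C_{01} is the total clone on 𝟚 generated by the two constant functions c_0 and c_1. -/
namespace StrongPartial

/-- Partial functions of arity `n+1` on `A` (arities are `≥ 1`).
`f.2 x = some a` means `x ∈ dom f` with value `a`; `f.2 x = none` means `x ∉ dom f`. -/
def PF (A : Type) : Type := Σ n : ℕ, (Fin (n+1) → A) → Option A

variable {A : Type}

/-- `f` is a total function. -/
def IsTotalPF (f : PF A) : Prop := ∀ x, (f.2 x).isSome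

/-- The set of all total functions on `A`. -/
def OSet (A : Type) : Set (PF A) := {f | IsTotalPF f}

/-- The `(n+1)`-ary projection onto the `i`-th coordinate. -/
def proj (n : ℕ) (i : Fin (n+1)) : PF A := ⟨n, fun x => some (x i)⟩

/-- Composition of an arity-`k` partial function with `k` partial functions of arity `m`. -/
def compFun {k m : ℕ} (f : (Fin k → A) → Option A) (g : Fin k → ((Fin m → A) → Option A)) :
    (Fin m → A) → Option A :=
  fun x => if h : ∀ i, (g i x).isSome then f (fun i => (g i x).get (h i)) else none

/-- A partial clone: contains all projections and is closed under composition. -/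
def IsPartialClone (X : Set (PF A)) : Prop :=
  (∀ (n : ℕ) (i : Fin (n+1)), proj n i ∈ X) ∧
  (∀ f ∈ X, ∀ (m : ℕ) (g : Fin (f.1+1) → ((Fin (m+1) → A) → Option A)),
     (∀ i, (⟨m, g i⟩ : PF A) ∈ X) → (⟨m, compFun f.2 g⟩ : PF A) ∈ X)

/-- A total clone: a partial clone consisting of total functions. -/
def IsClone (C : Set (PF A)) : Prop := IsPartialClone C ∧ C ⊆ OSet A

/-- `f ≤ g`: `f` is a restriction (subfunction) of `g`. -/
def PFle (f g : PF A) : Prop :=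
  ∃ h : f.1 = g.1, ∀ (x : Fin (f.1+1) → A) (a : A),
    f.2 x = some a → g.2 (fun i => x (Fin.cast (by rw [h]) i)) = some a

/-- `Str X`: all restrictions of members of `X`. -/
def StrSet (X : Set (PF A)) : Set (PF A) := {f | ∃ g ∈ X, PFle f g}

/-- `X` is strong (restriction closed). -/
def IsStrong (X : Set (PF A)) : Prop := StrSet X = X

/-- `f` preserves the `h`-ary relation `ρ`. -/
def Preserves (f : PF A) {h : ℕ} (ρ : Set (Fin h → A)) : Prop :=
  ∀ (M : Fin h → Fin (f.1+1) → A) (v : Fin h → A),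
    (∀ j, (fun i => M i j) ∈ ρ) → (∀ i, f.2 (M i) = some (v i)) → v ∈ ρ

def pPolSet {h : ℕ} (ρ : Set (Fin h → A)) : Set (PF A) := {f | Preserves f ρ}

def PolSet {h : ℕ} (ρ : Set (Fin h → A)) : Set (PF A) := pPolSet ρ ∩ OSet A

/-- `f` preserves the relation pair `(ρ, ρ')`. -/
def PreservesPair (f : PF A) {h : ℕ} (ρ ρ' : Set (Fin h → A)) : Prop :=
  ∀ (M : Fin h → Fin (f.1+1) → A) (v : Fin h → A),
    (∀ j, (fun i => M i j) ∈ ρ) → (∀ i, f.2 (M i) = some (v i)) → v ∈ ρ'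

def cPolSet {h : ℕ} (ρ ρ' : Set (Fin h → A)) : Set (PF A) := {f | PreservesPair f ρ ρ'}

/-- The interval `I_str(C)` of strong partial clones with total part `C`. -/
def Istr (C : Set (PF A)) : Set (Set (PF A)) :=
  {X | IsPartialClone X ∧ IsStrong X ∧ X ∩ OSet A = C}

/-! Maltsev operations -/

def zeta (f : PF A) : PF A := ⟨f.1, fun x => f.2 (fun i => x (i + 1))⟩

def tau (f : PF A) : PF A := ⟨f.1, fun x => f.2 (fun i => x (Equiv.swap 0 1 i))⟩

def nabla (f : PF A) : PF A := ⟨f.1 + 1, fun x => f.2 (fun i => x i.succ)⟩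

def delta (f : PF A) : PF A :=
  match f with
  | ⟨0, g⟩ => ⟨0, g⟩
  | ⟨n+1, g⟩ => ⟨n, fun x => g (fun i => x ⟨i.val - 1, by have := i.isLt; omega⟩)⟩

/-- `f ⋆ g`. -/
def starPF (f g : PF A) : PF A :=
  ⟨f.1 + g.1, fun x =>
    (g.2 (fun j => x ⟨j.val, by have := j.isLt; omega⟩)).bind
      (fun a => f.2 (fun i =>
        if i.val = 0 then a else x ⟨g.1 + i.val, by have := i.isLt; omega⟩))⟩

/-- A partial class: closed under `ζ`, `τ`, `Δ`, `∇` and `⋆`. -/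
def IsPartialClass (X : Set (PF A)) : Prop :=
  (∀ f ∈ X, zeta f ∈ X) ∧ (∀ f ∈ X, tau f ∈ X) ∧ (∀ f ∈ X, delta f ∈ X) ∧
  (∀ f ∈ X, nabla f ∈ X) ∧ (∀ f ∈ X, ∀ g ∈ X, starPF f g ∈ X)

def starSet (X Y : Set (PF A)) : Set (PF A) := {h | ∃ f ∈ X, ∃ g ∈ Y, h = starPF f g}

/-- The constant function of arity `n+1` with value `a`. -/
def constPF (a : A) (n : ℕ) : PF A := ⟨n, fun _ => some a⟩

/-- The total clone generated by a set `G` of total functions. -/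
def cloneGen (G : Set (PF A)) : Set (PF A) := ⋂₀ {C | IsClone C ∧ G ⊆ C}


/-! Boolean-specific definitions (`0 = false`, `1 = true`). -/

/-- `T_0 = Pol {(0)}`. -/
def relT0 : Set (Fin 1 → Bool) := {fun _ => false}

/-- `T_1 = Pol {(1)}`. -/
def relT1 : Set (Fin 1 → Bool) := {fun _ => true}

/-- `{(0,0),(0,1),(1,1)}`, defining the monotone functions. -/
def relM : Set (Fin 2 → Bool) := {![false, false], ![false, true], ![true, true]}

/-- `{(0,1),(1,0)}`, defining the self-dual functions. -/
def relS : Set (Fin 2 → Bool) := {![false, true], ![true, false]}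

/-- `{(x,x,y,y),(x,y,x,y),(x,y,y,x) : x,y ∈ 𝟚}`, defining the linear functions. -/
def relL : Set (Fin 4 → Bool) :=
  {v | ∃ x y : Bool, v = ![x, x, y, y] ∨ v = ![x, y, x, y] ∨ v = ![x, y, y, x]}

def T0 : Set (PF Bool) := PolSet relT0
def T1 : Set (PF Bool) := PolSet relT1
def Mclone : Set (PF Bool) := PolSet relM
def Sclone : Set (PF Bool) := PolSet relS
def Lclone : Set (PF Bool) := PolSet relL

/-- `ρ_{0,2} = {(0,0),(0,1),(1,0)}`. -/
def rel02 : Set (Fin 2 → Bool) := {![false, false], ![false, true], ![true, false]}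

/-- `T_{0,2} = Pol ρ_{0,2}`. -/
def T02 : Set (PF Bool) := PolSet rel02

/-- Cyclic successor on `Fin n`. -/
def cyc {n : ℕ} (i : Fin n) : Fin n := ⟨(i.val + 1) % n, Nat.mod_lt _ (by have := i.isLt; omega)⟩

/-- `R^{0,2}_{C,n}`: the cyclic-graph relation. -/
def RC (n : ℕ) : Set (Fin n → Bool) := {x | ∀ i : Fin n, ![x i, x (cyc i)] ∈ rel02}

/-- `R^{0,2}_{K,n}`: the complete-graph relation. -/
def RK (n : ℕ) : Set (Fin n → Bool) := {x | ∀ i j : Fin n, i ≠ j → ![x i, x j] ∈ rel02}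

/-- `R^{0,2}_n := R^{0,2}_{C,n} × R^{0,2}_{K,n} ⊆ 𝟚^{2n}`. -/
def R02 (n : ℕ) : Set (Fin (n + n) → Bool) :=
  {x | (fun i => x (Fin.castAdd n i)) ∈ RC n ∧ (fun i => x (Fin.natAdd n i)) ∈ RK n}

/-- The binary conjunction as a partial (total) function. -/
def andPF : PF Bool := ⟨1, fun x => some (x 0 && x 1)⟩

/-- The constant Boolean functions `c_0, c_1` of all arities. -/
def constantsBool : Set (PF Bool) :=
  {f | ∃ n : ℕ, f = constPF false n ∨ f = constPF true n}

/-- `C_{01}`: the clone generated by the constants `c_0, c_1`. -/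
def C01 : Set (PF Bool) := cloneGen constantsBool

/-- `Λ`: the clone generated by `∧, c_0, c_1`. -/
def LambdaClone : Set (PF Bool) := cloneGen (insert andPF constantsBool)

/-- The monster relation `R^Λ_m ⊆ 𝟚^{m+1}` (coordinates 0-indexed: index 0 is the paper's 1). -/
def RLam (m : ℕ) : Set (Fin (m+1) → Bool) :=
  {x | (x 0 = true ∨ ∃ j : Fin (m+1), j ≠ 0 ∧ x j = false) ∧
       ∀ i j1 j2 : Fin (m+1), i ≠ 0 → j1 ≠ 0 → j2 ≠ 0 → i ≠ j1 → i ≠ j2 → j1 ≠ j2 →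
         (x i = true ∨ x 0 = false ∨ x j1 = false ∨ x j2 = false)}

/-- `n(k,p) := (2k−1)p + 1`. -/
def nkp (k p : ℕ) : ℕ := (2 * k - 1) * p + 1

/-- The `n(k,p)`-ary partial function `τ_p^k`. -/
def tauPF (k p : ℕ) : PF Bool :=
  ⟨nkp k p - 1, fun x =>
    if ∀ i, x i = true then some true
    else if (Finset.univ.filter (fun i => x i = true)).card ≤ p then some false
    else none⟩

/-- `p_1 := 1`, `p_j := n(j, p_{j−1})` for `j ≥ 2`. -/
def pseq : ℕ → ℕ
  | 0 => 1
  | 1 => 1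
  | (j+2) => nkp (j+2) (pseq (j+1))

/-- `ξ_j := τ^{j+1}_{p_j}`. -/
def xi (j : ℕ) : PF Bool := tauPF (j + 1) (pseq j)

/-- `ρ_C = {(0,0,0,0),(0,0,1,1),(0,1,0,1),(1,1,1,1)}`. -/
def rhoC : Set (Fin 4 → Bool) :=
  {![false, false, false, false], ![false, false, true, true],
   ![false, true, false, true], ![true, true, true, true]}

/-- `ρ_1 = ρ_C ∪ {(1,0,1,0),(1,1,0,0)}`. -/
def rho1 : Set (Fin 4 → Bool) :=
  rhoC ∪ {![true, false, true, false], ![true, true, false, false]}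

/-- `f_a`: extension of `f` fixing the new first coordinate to `a`. -/
def extConst {A : Type} [DecidableEq A] (a : A) (f : PF A) : PF A :=
  ⟨f.1 + 1, fun x => if x 0 = a then f.2 (fun i => x i.succ) else none⟩




lemma compFun_some {k m : ℕ} {f : (Fin k → Bool) → Option Bool}
    {g : Fin k → ((Fin m → Bool) → Option Bool)} {x : Fin m → Bool} {v : Bool}
    (h : compFun f g x = some v) :
    ∃ y : Fin k → Bool, (∀ i, g i x = some (y i)) ∧ f y = some v := by
  unfold compFun at h
  split_ifs at h with h1
  exact ⟨_, fun i => by simp, h⟩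

lemma pPol_clone {h : ℕ} (ρ : Set (Fin h → Bool)) : IsPartialClone (pPolSet ρ) := by
  refine ⟨?_, ?_⟩
  · intro n i M v hM hv
    have : v = fun k => M k i := by
      funext k
      have := hv k
      simp only [proj, Option.some.injEq] at this
      exact this.symm
    rw [this]
    exact hM i
  · intro f hf m g hg M v hM hv
    choose y hy1 hy2 using fun i => compFun_some (hv i)
    exact hf y v (fun j => hg j M _ hM (fun i => hy1 i j)) hy2

lemma pPol_str {h : ℕ} (ρ : Set (Fin h → Bool)) {f g : PF Bool} (hg : g ∈ pPolSet ρ)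
    (hfg : PFle f g) : f ∈ pPolSet ρ := by
  obtain ⟨n, f⟩ := f
  obtain ⟨m, g⟩ := g
  obtain ⟨e, H⟩ := hfg
  simp only at e
  subst e
  intro M v hM hv
  exact hg M v hM (fun i => H _ _ (hv i))

lemma mem_rhoC (v : Fin 4 → Bool) :
    v ∈ rhoC ↔ v 0 = (v 1 && v 2) ∧ v 3 = (v 1 || v 2) := by
  have e : v = ![v 0, v 1, v 2, v 3] := by
    funext i; fin_cases i <;> rfl
  rw [e]
  generalize v 0 = a
  generalize v 1 = b
  generalize v 2 = c
  generalize v 3 = d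
  simp only [rhoC, Set.mem_insert_iff, Set.mem_singleton_iff]
  revert a b c d
  decide

/-- separating functions -/
def sepF (n : ℕ) : PF Bool := ⟨n + 2, fun x =>
  if ∀ i, x i = true then some true
  else if ∃ p, ∀ i, x i = decide (i = p) then some false else none⟩

lemma sepF_some {n : ℕ} {x : Fin (n+2+1) → Bool} {v : Bool} (h : (sepF n).2 x = some v) :
    (v = true ∧ ∀ i, x i = true) ∨ (v = false ∧ ∃ p, ∀ i, x i = true ↔ i = p) := by
  simp only [sepF] at h
  split_ifs at h with h1 h2
  · left; exact ⟨by simpa using h.symm, h1⟩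
  · right
    obtain ⟨p, hp⟩ := h2
    exact ⟨by simpa using h.symm, p, fun i => by rw [hp i]; simp⟩

/-- separating relations -/
def sepR (n : ℕ) : Set (Fin (n+2+1+1) → Bool) :=
  {x | (∀ i, x i = x 0) ∨ (x 0 = true ∧ ∃ j, ∀ i : Fin (n+2+1), x i.succ = true ↔ i = j)}

lemma sepF_rhoC (n : ℕ) : sepF n ∈ pPolSet rhoC := by
  intro M v hM hv
  have hM' := fun j => (mem_rhoC _).1 (hM j)
  rw [mem_rhoC]
  have h := fun i => sepF_some (hv i)
  have e1 : (∀ i, M 1 i = true) → M 0 = M 2 ∧ M 3 = M 1 := fun H =>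
    ⟨by funext j; rw [(hM' j).1, H]; simp, by funext j; rw [(hM' j).2, H]; simp⟩
  have e2 : (∀ i, M 2 i = true) → M 0 = M 1 ∧ M 3 = M 2 := fun H =>
    ⟨by funext j; rw [(hM' j).1, H]; simp, by funext j; rw [(hM' j).2, H]; simp⟩
  have key : ∀ i j, M i = M j → v i = v j := by
    intro i j hij
    have a := hv i
    rw [hij, hv j] at a
    simpa using a.symm
  rcases h 1 with ⟨a1, b1⟩ | ⟨a1, p, b1⟩
  · obtain ⟨q1, q2⟩ := e1 b1
    rw [key _ _ q1, key _ _ q2, a1]; simp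
  rcases h 2 with ⟨a2, b2⟩ | ⟨a2, q, b2⟩
  · obtain ⟨q1, q2⟩ := e2 b2
    rw [key _ _ q1, key _ _ q2, a2]; simp
  by_cases hpq : p = q
  · subst hpq
    have e : M 1 = M 2 := by
      funext j; exact Bool.eq_iff_iff.2 ((b1 j).trans (b2 j).symm)
    have f0 : M 0 = M 1 := by
      funext j; rw [(hM' j).1, ← e]; simp
    have f3 : M 3 = M 1 := by
      funext j; rw [(hM' j).2, ← e]; simp
    rw [key _ _ f0, key _ _ f3, key _ _ e]; simp
  · exfalso
    have z : ∀ j, ¬ M 0 j = true := by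
      intro j hj
      rw [(hM' j).1, Bool.and_eq_true] at hj
      exact hpq (((b1 j).1 hj.1).symm.trans ((b2 j).1 hj.2))
    rcases h 0 with ⟨_, b⟩ | ⟨_, r, b⟩
    · exact z 0 (b 0)
    · exact z r ((b r).2 rfl)

lemma sepF_not (n : ℕ) : sepF n ∉ pPolSet (sepR n) := by
  intro H
  let M : Fin (n+2+1+1) → Fin (n+2+1) → Bool :=
    Fin.cons (fun _ => true) (fun i j => decide (j = i))
  have := H M (Fin.cons true (fun _ => false)) ?_ ?_
  · rcases this with h | ⟨-, j, h⟩
    · have := h (Fin.succ 0); simp at this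
    · have := (h j).2 rfl; simp at this
  · intro j
    right
    refine ⟨rfl, j, fun i => ?_⟩
    change Fin (n+2+1) at j
    change decide (j = i) = true ↔ i = j
    rw [decide_eq_true_eq]
    exact eq_comm
  · intro i
    refine Fin.cases ?_ (fun i => ?_) i
    · simp [sepF, M]
    · simp only [sepF, M, Fin.cons_succ]
      rw [if_neg, if_pos ⟨i, fun _ => rfl⟩]
      intro h
      have h0 := h 0
      have h1 := h 1
      simp only [decide_eq_true_eq] at h0 h1
      rw [← h0] at h1
      simp at h1

lemma sepF_pres {m n : ℕ} (hmn : m ≠ n) : sepF m ∈ pPolSet (sepR n) := by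
  intro M v hM hv
  change Fin (n+2+1+1) → Fin (m+2+1) → Bool at M
  have h := fun i => sepF_some (hv i)
  have key : ∀ i j, M i = M j → v i = v j := by
    intro i j hij
    have a := hv i
    rw [hij, hv j] at a
    simpa using a.symm
  have mono : ∀ i p, M i p = true → M 0 p = true := by
    intro i p hp
    rcases hM p with h | ⟨h, -⟩
    · exact (h i).symm.trans hp
    · exact h
  -- full rows
  have full : ∀ i, v i = true → ∀ p, M i p = true := by
    intro i hi p
    rcases h i with ⟨_, b⟩ | ⟨a, _⟩
    · exact b p
    · rw [a] at hi; cases hi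
  have sing : ∀ i, v i = false → ∃ p, ∀ q, M i q = true ↔ q = p := by
    intro i hi
    rcases h i with ⟨a, b⟩ | ⟨_, b⟩
    · rw [a] at hi; cases hi
    · exact b
  have nonz : ∀ i, ∃ p, M i p = true := by
    intro i
    rcases h i with ⟨_, b⟩ | ⟨_, p, b⟩
    · exact ⟨0, b 0⟩
    · exact ⟨p, (b p).2 rfl⟩
  cases h0 : v 0
  · left
    obtain ⟨p, hp⟩ := sing 0 h0
    intro i
    rw [h0]
    by_contra hc
    have hc : v i = true := by simpa using hc
    have a0 := (hp 0).1 (mono i 0 (full i hc 0))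
    have a1 := (hp 1).1 (mono i 1 (full i hc 1))
    rw [← a0] at a1
    simp at a1
  by_cases hex : ∃ j : Fin (n+2+1), v j.succ = true
  · obtain ⟨j, hj⟩ := hex
    by_cases hu : ∀ i : Fin (n+2+1), v i.succ = true → i = j
    · right
      exact ⟨h0, j, fun i => ⟨hu i, fun e => by rw [e]; exact hj⟩⟩
    · push Not at hu
      obtain ⟨i, hi, hij⟩ := hu
      left
      have : ∀ p k, M k p = true := by
        intro p
        rcases hM p with h | ⟨-, t, h⟩
        · intro k
          have e1 : M k p = M 0 p := h k
          rw [e1]; exact full 0 h0 p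
        · exact absurd (((h i).1 (full _ hi p)).trans ((h j).1 (full _ hj p)).symm) hij
      intro k
      apply key
      funext p
      rw [this, this]
  · exfalso
    push Not at hex
    have hex : ∀ j : Fin (n+2+1), v j.succ = false := fun j => by simpa using hex j
    choose s hs using fun j => sing _ (hex j)
    have nc : ∀ p, ∃ t, ∀ i : Fin (n+2+1), M i.succ p = true ↔ i = t := by
      by_contra hc
      push Not at hc
      obtain ⟨p, hp⟩ := hc
      have cp : ∀ i : Fin (n+2+1), s i = p := by
        rcases hM p with h | ⟨-, t, h⟩
        · intro i
          have e1 : M i.succ p = M 0 p := h i.succ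
          rw [full 0 h0 p] at e1
          exact ((hs i p).1 e1).symm
        · obtain ⟨i, hi⟩ := hp t
          have := h i
          simp only at this
          tauto
      obtain ⟨q, hq⟩ := exists_ne p
      rcases hM q with h | ⟨-, t, h⟩
      · have e1 : M (Fin.succ 0) q = M 0 q := h _
        rw [full 0 h0 q] at e1
        exact hq (((hs _ q).1 e1).trans (cp _))
      · exact hq (((hs _ q).1 ((h t).2 rfl)).trans (cp _))
    choose t ht using nc
    have bij : Function.Bijective s := by
      refine Function.bijective_iff_has_inverse.2 ⟨t, fun i => ?_, fun p => ?_⟩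
      · exact ((ht _ i).1 ((hs i _).2 rfl)).symm
      · exact ((hs _ p).1 ((ht p _).2 rfl)).symm
    have := Fintype.card_of_bijective bij
    simp at this
    exact hmn this.symm

/-- the family of strong partial clones -/
def XA (A : Set ℕ) : Set (PF Bool) := {f | f ∈ pPolSet rhoC ∧ ∀ n ∈ A, f ∈ pPolSet (sepR n)}

lemma XA_clone (A : Set ℕ) : IsPartialClone (XA A) := by
  refine ⟨fun n i => ⟨(pPol_clone _).1 n i, fun k _ => (pPol_clone _).1 n i⟩, ?_⟩
  intro f hf m g hg
  exact ⟨(pPol_clone _).2 f hf.1 m g (fun i => (hg i).1),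
    fun k hk => (pPol_clone _).2 f (hf.2 k hk) m g (fun i => (hg i).2 k hk)⟩

lemma PFle_refl (f : PF Bool) : PFle f f := ⟨rfl, fun _ _ h => h⟩

lemma XA_strong (A : Set ℕ) : IsStrong (XA A) := by
  apply Set.Subset.antisymm
  · rintro f ⟨g, hg, hfg⟩
    exact ⟨pPol_str _ hg.1 hfg, fun n hn => pPol_str _ (hg.2 n hn) hfg⟩
  · intro f hf
    exact ⟨f, hf, PFle_refl f⟩

lemma inter_O_clone {X : Set (PF Bool)} (hX : IsPartialClone X) : IsClone (X ∩ OSet Bool) := by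
  refine ⟨⟨fun n i => ⟨hX.1 n i, fun x => by simp [proj]⟩, ?_⟩, Set.inter_subset_right⟩
  intro f hf m g hg
  refine ⟨hX.2 f hf.1 m g (fun i => (hg i).1), fun x => ?_⟩
  have : ∀ i, (g i x).isSome := fun i => (hg i).2 x
  simp only [compFun]
  rw [dif_pos this]
  exact hf.2 _

lemma const_pPol {h : ℕ} (ρ : Set (Fin h → Bool)) (a : Bool) (ha : (fun _ => a) ∈ ρ) (n : ℕ) :
    constPF a n ∈ pPolSet ρ := by
  intro M v _ hv
  have : v = fun _ => a := by
    funext i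
    have := hv i
    simp only [constPF, Option.some.injEq] at this
    exact this.symm
  rw [this]; exact ha

lemma const_XA (A : Set ℕ) (a : Bool) (n : ℕ) : constPF a n ∈ XA A :=
  ⟨const_pPol _ a ((mem_rhoC _).2 (by simp)) n, fun k _ => const_pPol _ a (Or.inl fun _ => rfl) n⟩

lemma total_rhoC {f : PF Bool} (hf : f ∈ pPolSet rhoC) (ht : IsTotalPF f) :
    (∃ i, f = proj f.1 i) ∨ ∃ a, f = constPF a f.1 := by
  obtain ⟨n, f⟩ := f
  have : ∃ g : (Fin (n+1) → Bool) → Bool, f = fun x => some (g x) :=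
    ⟨fun x => (f x).get (ht x), by funext x; simp⟩
  obtain ⟨g, rfl⟩ := this
  have hom : ∀ a b : Fin (n+1) → Bool,
      g (fun i => a i && b i) = (g a && g b) ∧ g (fun i => a i || b i) = (g a || g b) := by
    intro a b
    have := hf ![fun i => a i && b i, a, b, fun i => a i || b i]
      (fun k => g (![fun i => a i && b i, a, b, fun i => a i || b i] k)) ?_ ?_
    · exact (mem_rhoC _).1 this
    · intro j
      rw [mem_rhoC]
      simp
    · intro i; rfl
  by_cases h1 : g (fun _ => true) = false
  · right; refine ⟨false, ?_⟩
    simp only [constPF]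
    congr 1
    funext x
    have := (hom x (fun _ => true)).1
    simp only [Bool.and_true, h1, Bool.and_false] at this
    rw [this]
  by_cases h2 : g (fun _ => false) = true
  · right; refine ⟨true, ?_⟩
    simp only [constPF]
    congr 1
    funext x
    have := (hom x (fun _ => false)).2
    simp only [Bool.or_false, h2, Bool.or_true] at this
    rw [this]
  have h1 : g (fun _ => true) = true := by simpa using h1
  have h2 : g (fun _ => false) = false := by simpa using h2
  have h3 : ∃ i, g (fun j => decide (j = i)) = true := by
    by_contra hc
    push Not at hc
    have : ∀ s : Finset (Fin (n+1)), g (fun j => decide (j ∈ s)) = false := by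
      intro s
      induction s using Finset.induction_on with
      | empty => simpa using h2
      | insert a s _ ih =>
        have e := (hom (fun j => decide (j = a)) (fun j => decide (j ∈ s))).2
        rw [ih, Bool.eq_false_iff.2 (hc a)] at e
        simpa [Finset.mem_insert] using e
    have := this Finset.univ
    simp [h1] at this
  obtain ⟨i, hi⟩ := h3
  left
  refine ⟨i, ?_⟩
  simp only [proj]
  congr 1
  funext x
  congr 1
  have e := (hom (fun j => decide (j = i)) x).1
  rw [hi, Bool.true_and] at e
  rw [← e]
  cases hx : x i
  · rw [← h2]; congr 1; funext j
    by_cases hj : j = i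
    · subst hj; simp [hx]
    · simp [hj]
  · rw [← hi]; congr 1; funext j
    by_cases hj : j = i
    · subst hj; simp [hx]
    · simp [hj]

lemma XA_total (A : Set ℕ) : XA A ∩ OSet Bool = C01 := by
  apply Set.Subset.antisymm
  · rintro f ⟨hf, ht⟩ C ⟨hC, hG⟩
    rcases total_rhoC hf.1 ht with ⟨i, h⟩ | ⟨a, h⟩
    · rw [h]; exact hC.1.1 _ _
    · rw [h]; apply hG
      refine ⟨f.1, ?_⟩
      cases a <;> simp
  · apply Set.sInter_subset_of_mem
    refine ⟨inter_O_clone (XA_clone A), ?_⟩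
    rintro f ⟨n, rfl | rfl⟩
    · exact ⟨const_XA A _ n, fun _ => rfl⟩
    · exact ⟨const_XA A _ n, fun _ => rfl⟩

lemma mem_XA_sep (A : Set ℕ) (n : ℕ) : sepF n ∈ XA A ↔ n ∉ A := by
  constructor
  · intro h hn
    exact sepF_not n (h.2 n hn)
  · intro h
    refine ⟨sepF_rhoC n, fun k hk => sepF_pres ?_⟩
    rintro rfl
    exact h hk

theorem Istr_C01_continuum : Cardinal.mk ↥(Istr C01) = Cardinal.continuum := by
  apply le_antisymm
  · refine (Cardinal.mk_set_le _).trans ?_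
    rw [Cardinal.mk_set, ← Cardinal.two_power_aleph0]
    apply Cardinal.power_le_power_left two_ne_zero
    rw [Cardinal.mk_le_aleph0_iff]
    unfold PF
    infer_instance
  · have : Cardinal.mk (Set ℕ) = Cardinal.continuum := by simp
    rw [← this]
    refine Cardinal.mk_le_of_injective
      (f := fun A => (⟨XA A, XA_clone A, XA_strong A, XA_total A⟩ : ↥(Istr C01))) ?_
    intro A B h
    have h : XA A = XA B := congrArg Subtype.val h
    ext n
    have := mem_XA_sep A n
    rw [h, mem_XA_sep] at this
    tauto

end StrongPartial
end

section
/- Let T be the set of all partial functions f on 𝟚 such that the all-zero tuple (0,…,0) of the appropriate arity does not belong to dom f. Let N̂ := {n ∈ ℕ : n odd, n ≥ 3}, n ∈ N̂, and M ⊆ N̂ \ {n}. Then pPol R^{0,2}_n does not contain T ∩ ⋂_{m ∈ M} pPol R^{0,2}_m; i.e. there exists a partial function F ∈ T preserving R^{0,2}_m for every m ∈ M but not preserving R^{0,2}_n. -/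
namespace StrongPartial

variable {A : Type}

theorem mem_rel02_iff (a b : Bool) : ![a, b] ∈ rel02 ↔ ¬ (a = true ∧ b = true) := by
  cases a <;> cases b <;> simp [rel02, funext_iff, Fin.forall_fin_two]

def gAdj (n : ℕ) : Fin n ⊕ Fin n → Fin n ⊕ Fin n → Prop
  | .inl i, .inl j => j = cyc i ∨ i = cyc j
  | .inr i, .inr j => i ≠ j
  | _, _ => False

theorem gAdj_symm {n : ℕ} {u v : Fin n ⊕ Fin n} (h : gAdj n u v) : gAdj n v u := by
  rcases u with u | u <;> rcases v with v | v <;> simp only [gAdj] at h ⊢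
  · exact h.symm
  · exact h.symm

theorem gAdj_isLeft {n : ℕ} {u v : Fin n ⊕ Fin n} (h : gAdj n u v) : u.isLeft = v.isLeft := by
  rcases u with u | u <;> rcases v with v | v <;> simp_all [gAdj]

theorem cyc_ne {n : ℕ} (hn : 2 ≤ n) (i : Fin n) : cyc i ≠ i := by
  intro h
  have h' := congrArg Fin.val h
  simp only [cyc] at h'
  have := i.isLt
  by_cases hi : i.val + 1 = n
  · rw [hi, Nat.mod_self] at h'; omega
  · rw [Nat.mod_eq_of_lt (by omega)] at h'; omega

theorem gAdj_irrefl {n : ℕ} (hn : 2 ≤ n) (u : Fin n ⊕ Fin n) : ¬ gAdj n u u := by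
  rcases u with u | u <;> simp only [gAdj]
  · have := cyc_ne hn u
    tauto
  · simp

theorem cyc_dvd {n : ℕ} (i : Fin n) : (n : ℤ) ∣ ((cyc i).val : ℤ) - i.val - 1 := by
  have h : (n : ℤ) ∣ (((i.val + 1 : ℕ) : ℤ) % (n : ℤ)) - ((i.val + 1 : ℕ) : ℤ) :=
    Int.dvd_sub_self_of_emod_eq rfl
  simp only [cyc]
  push_cast at h ⊢
  rw [sub_sub]
  exact h

theorem walk_false {n m : ℕ} (f : ℕ → Fin n)
    (hf : ∀ k, f (k+1) = cyc (f k) ∨ f k = cyc (f (k+1)))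
    (hm : f m = f 0) (hodd : Odd m) (hlt : m < n) : False := by
  have key : ∀ k : ℕ, ∃ d : ℤ, |d| ≤ k ∧ (2 : ℤ) ∣ d - k ∧
      (n : ℤ) ∣ ((f k).val : ℤ) - (f 0).val - d := by
    intro k
    induction k with
    | zero => exact ⟨0, by simp⟩
    | succ k ih =>
      obtain ⟨d, h1, h2, h3⟩ := ih
      rw [abs_le] at h1
      rcases hf k with h | h
      · refine ⟨d + 1, ?_, ?_, ?_⟩
        · rw [abs_le]; push_cast; omega
        · push_cast; omega
        · have := dvd_add h3 (cyc_dvd (f k))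
          rw [h]
          refine (Dvd.dvd.trans (dvd_refl _) this).trans (dvd_of_eq ?_)
          ring
      · refine ⟨d - 1, ?_, ?_, ?_⟩
        · rw [abs_le]; push_cast; omega
        · push_cast; omega
        · have := dvd_sub h3 (cyc_dvd (f (k+1)))
          rw [← h] at this
          refine (Dvd.dvd.trans (dvd_refl _) this).trans (dvd_of_eq ?_)
          ring
  obtain ⟨d, h1, h2, h3⟩ := key m
  rw [hm] at h3
  have h4 : (n : ℤ) ∣ d := by simpa using h3
  have h5 : d = 0 := Int.eq_zero_of_abs_lt_dvd h4 (by omega)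
  obtain ⟨r, hr⟩ := hodd
  omega

theorem cycle_right {n m : ℕ} (hodd : Odd m) (hlt : m < n) (u : Fin m → Fin n ⊕ Fin n)
    (hu : ∀ i, gAdj n (u i) (u (cyc i))) (i : Fin m) : (u i).isLeft = false := by
  have hm : 0 < m := hodd.pos
  let g : ℕ → Fin n ⊕ Fin n := fun k => u ⟨k % m, Nat.mod_lt _ hm⟩
  have hg : ∀ k, gAdj n (g k) (g (k+1)) := by
    intro k
    have h := hu ⟨k % m, Nat.mod_lt _ hm⟩
    have e : cyc (⟨k % m, Nat.mod_lt _ hm⟩ : Fin m) = ⟨(k+1) % m, Nat.mod_lt _ hm⟩ := by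
      apply Fin.ext; simp [cyc]
    rw [e] at h
    exact h
  have hl : ∀ k, (g k).isLeft = (g 0).isLeft := by
    intro k
    induction k with
    | zero => rfl
    | succ k ih => rw [← gAdj_isLeft (hg k), ih]
  have hi : g i = u i := by
    simp [g, Nat.mod_eq_of_lt i.isLt]
  rw [← hi, hl]
  by_contra hc
  have hc : (g 0).isLeft = true := by simpa using hc
  have hex : ∀ k, ∃ a, g k = Sum.inl a := fun k => by
    have := hl k
    rw [hc] at this
    exact Sum.isLeft_iff.mp this
  choose f hf using hex
  refine walk_false f (m := m) ?_ ?_ hodd hlt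
  · intro k
    have := hg k
    rw [hf, hf] at this
    exact this
  · have : g m = g 0 := by simp [g]
    rw [hf, hf] at this
    exact Sum.inl_injective this

theorem clique_le {n m : ℕ} (hn : 2 ≤ n) (u : Fin m → Fin n ⊕ Fin n)
    (hu : ∀ i j, i ≠ j → gAdj n (u i) (u j)) : m ≤ n := by
  let p : Fin n ⊕ Fin n → Fin n := Sum.elim id id
  have : Function.Injective (p ∘ u) := by
    intro i j h
    by_contra hne
    have h1 := hu i j hne
    have h2 := gAdj_isLeft h1
    have h3 : u i = u j := by
      rcases hi : u i with a | a <;> rcases hj : u j with b | b <;> simp_all [p]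
    rw [h3] at h1
    exact gAdj_irrefl hn _ h1
  simpa using Fintype.card_le_of_injective _ this

open Classical in
noncomputable def gRow (n N : ℕ) (e : Fin N → (Fin n ⊕ Fin n) × (Fin n ⊕ Fin n))
    (u : Fin n ⊕ Fin n) : Fin N → Bool :=
  fun c => decide (¬ gAdj n (e c).1 (e c).2 ∧ (u = (e c).1 ∨ u = (e c).2))

open Classical in
noncomputable def gF (n N : ℕ) (e : Fin (N+1) → (Fin n ⊕ Fin n) × (Fin n ⊕ Fin n)) : PF Bool :=
  ⟨N, fun x => if h : ∃ u, x = gRow n (N+1) e u then some (h.choose).isLeft else none⟩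

theorem gRow_disj {n N : ℕ} (hn : 2 ≤ n) {e : Fin N → (Fin n ⊕ Fin n) × (Fin n ⊕ Fin n)}
    (he : Function.Surjective e) (u v : Fin n ⊕ Fin n) :
    gAdj n u v ↔ ∀ c, ![gRow n N e u c, gRow n N e v c] ∈ rel02 := by
  simp only [mem_rel02_iff, gRow, decide_eq_true_eq]
  constructor
  · rintro h c ⟨⟨h1, h2⟩, -, h3⟩
    have hne : u ≠ v := fun hh => gAdj_irrefl hn v (hh ▸ h)
    rcases h2 with h2 | h2 <;> rcases h3 with h3 | h3
    · exact hne (h2.trans h3.symm)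
    · rw [← h2, ← h3] at h1; exact h1 h
    · rw [← h2, ← h3] at h1; exact h1 (gAdj_symm h)
    · exact hne (h2.trans h3.symm)
  · intro h
    by_contra hc
    obtain ⟨c, hcc⟩ := he (u, v)
    apply h c
    rw [hcc]
    simp [hc]

theorem gRow_diag {n N : ℕ} (hn : 2 ≤ n) {e : Fin N → (Fin n ⊕ Fin n) × (Fin n ⊕ Fin n)}
    {u v : Fin n ⊕ Fin n} {c : Fin N} (hc : e c = (u, u)) :
    gRow n N e v c = true ↔ v = u := by
  simp [gRow, hc, gAdj_irrefl hn]

theorem gRow_inj {n N : ℕ} (hn : 2 ≤ n) {e : Fin N → (Fin n ⊕ Fin n) × (Fin n ⊕ Fin n)}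
    (he : Function.Surjective e) : Function.Injective (gRow n N e) := by
  intro u v h
  obtain ⟨c, hc⟩ := he (u, u)
  have h1 : gRow n N e u c = true := (gRow_diag hn hc).2 rfl
  rw [h] at h1
  exact ((gRow_diag hn hc).1 h1).symm

theorem gF_row {n N : ℕ} (hn : 2 ≤ n) {e : Fin (N+1) → (Fin n ⊕ Fin n) × (Fin n ⊕ Fin n)}
    (he : Function.Surjective e) (u : Fin n ⊕ Fin n) :
    (gF n N e).2 (gRow n (N+1) e u) = some u.isLeft := by
  have h : ∃ w, gRow n (N+1) e u = gRow n (N+1) e w := ⟨u, rfl⟩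
  have h2 : h.choose = u := (gRow_inj hn he h.choose_spec).symm
  simp only [gF]
  rw [dif_pos h, h2]

theorem gF_some {n N : ℕ} (hn : 2 ≤ n) {e : Fin (N+1) → (Fin n ⊕ Fin n) × (Fin n ⊕ Fin n)}
    (he : Function.Surjective e) {x : Fin (N+1) → Bool} {b : Bool}
    (h : (gF n N e).2 x = some b) : ∃ u, x = gRow n (N+1) e u ∧ b = u.isLeft := by
  by_cases hx : ∃ u, x = gRow n (N+1) e u
  · obtain ⟨u, rfl⟩ := hx
    rw [gF_row hn he] at h
    exact ⟨u, rfl, by simpa using h.symm⟩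
  · simp only [gF] at h
    rw [dif_neg hx] at h
    cases h

theorem R02_nonconstructible_in_T (n : ℕ) (hn : 3 ≤ n) (hodd : Odd n)
    (M : Set ℕ) (hM : ∀ m ∈ M, Odd m ∧ 3 ≤ m ∧ m ≠ n) :
    ¬ ({f : PF Bool | f.2 (fun _ => false) = none} ∩
        {f : PF Bool | ∀ m ∈ M, Preserves f (R02 m)} ⊆ pPolSet (R02 n)) := by
  have hn2 : 2 ≤ n := by omega
  obtain ⟨N, e, he⟩ : ∃ (N : ℕ) (e : Fin (N+1) → (Fin n ⊕ Fin n) × (Fin n ⊕ Fin n)),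
      Function.Surjective e := by
    have hc : Fintype.card ((Fin n ⊕ Fin n) × (Fin n ⊕ Fin n)) =
        ((n + n) * (n + n) - 1) + 1 := by
      have : 0 < (n + n) * (n + n) := by positivity
      simp
      omega
    exact ⟨_, _, (Fintype.equivFinOfCardEq hc).symm.surjective⟩
  intro hsub
  have hF : gF n N e ∈ pPolSet (R02 n) := by
    apply hsub
    refine ⟨?_, ?_⟩
    · show (gF n N e).2 (fun _ => false) = none
      by_contra hc
      obtain ⟨b, hb⟩ := Option.ne_none_iff_exists'.mp hc
      obtain ⟨u, hu, -⟩ := gF_some hn2 he hb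
      obtain ⟨c, hc⟩ := he (u, u)
      have h1 := (gRow_diag hn2 hc).2 (rfl : u = u)
      rw [← hu] at h1
      cases h1
    · intro m hm A v hA hv
      obtain ⟨hmo, hm3, hmn⟩ := hM m hm
      choose u hu huv using fun i => gF_some hn2 he (hv i)
      have hC : ∀ i : Fin m, gAdj n (u (Fin.castAdd m i)) (u (Fin.castAdd m (cyc i))) := by
        intro i
        rw [gRow_disj hn2 he]
        intro c
        have := (hA c).1 i
        rw [← hu, ← hu]
        exact this
      have hK : ∀ i j : Fin m, i ≠ j → gAdj n (u (Fin.natAdd m i)) (u (Fin.natAdd m j)) := by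
        intro i j hij
        rw [gRow_disj hn2 he]
        intro c
        have := (hA c).2 i j hij
        rw [← hu, ← hu]
        exact this
      have hlt : m < n := lt_of_le_of_ne (clique_le hn2 _ hK) hmn
      have hC' := cycle_right hmo hlt _ hC
      have hK' := cycle_right hmo hlt (fun i => u (Fin.natAdd m i))
        (fun i => hK i (cyc i) (cyc_ne (by omega) i).symm)
      refine ⟨fun i => ?_, fun i j _ => ?_⟩
      · rw [mem_rel02_iff]
        simp only [huv, hC']
        simp
      · rw [mem_rel02_iff]
        simp only [huv]
        have := hK' i
        simp_all
  let w : Fin (n + n) → Fin n ⊕ Fin n := finSumFinEquiv.symm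
  have hwl : ∀ i : Fin n, w (Fin.castAdd n i) = Sum.inl i := fun i => by simp [w]
  have hwr : ∀ i : Fin n, w (Fin.natAdd n i) = Sum.inr i := fun i => finSumFinEquiv_symm_apply_natAdd i
  have h := hF (fun i => gRow n (N+1) e (w i)) (fun i => (w i).isLeft) ?_
    (fun i => gF_row hn2 he (w i))
  · have h0 := h.1 ⟨0, by omega⟩
    rw [mem_rel02_iff] at h0
    simp only [hwl] at h0
    exact h0 ⟨rfl, rfl⟩
  · intro c
    refine ⟨fun i => ?_, fun i j hij => ?_⟩
    · refine (gRow_disj hn2 he _ _).1 ?_ c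
      rw [hwl, hwl]
      exact Or.inl rfl
    · refine (gRow_disj hn2 he _ _).1 ?_ c
      rw [hwr, hwr]
      exact hij
end StrongPartial
end
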